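/- For every y ∈ ℝᵐ and ξ a standard Gaussian vector in ℝᵐ, E|Σ_{i=1}^m y_i ξ_i²| ≥ (2/π)·‖y‖₂. Consequently, for m > 1 and γ ≥ 0, θ_m(γ) := E[(ξ₁² − (γ/(m−1)) Σ_{j=2}^m ξⱼ²)₊] satisfies θ_m(γ) ≥ (1/2)·(1 − γ + (2/π)·√(1 + γ²/(m−1)))₊. -/

import Mathlib

open MeasureTheory ProbabilityTheory Real
open scoped BigOperators

/-- The standard Gaussian measure on `ℝᵐ` (i.i.d. standard normal coordinates). -/
noncomputable def stdGaussian (m : ℕ) : Measure (Fin m → ℝ) :=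
  Measure.pi fun _ => gaussianReal 0 1

noncomputable abbrev sgm (m : ℕ) : Measure (Fin m → ℝ) := _root_.stdGaussian m

instance sgm_prob (m : ℕ) : IsProbabilityMeasure (_root_.stdGaussian m) := by
  unfold _root_.stdGaussian; infer_instance

instance sgm_gauss (m : ℕ) : IsGaussian (_root_.stdGaussian m) := by
  have h : (sgm m) = (ProbabilityTheory.stdGaussian (EuclideanSpace ℝ (Fin m))).map
      (PiLp.continuousLinearEquiv 2 ℝ (fun _ : Fin m => ℝ) : EuclideanSpace ℝ (Fin m) →L[ℝ] (Fin m → ℝ)) := by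
    rw [← map_pi_eq_stdGaussian, Measure.map_map (by fun_prop) (by fun_prop)]
    symm
    exact Measure.map_id
  change IsGaussian (sgm m)
  rw [h]
  infer_instance

lemma sgm_mp (m : ℕ) (i : Fin m) :
    MeasurePreserving (fun ξ : Fin m → ℝ => ξ i) (_root_.stdGaussian m) (gaussianReal 0 1) :=
  measurePreserving_eval _ i

lemma int_abs_gauss : ∫ x, |x| ∂(gaussianReal 0 1) = √(2 / π) := by
  rw [integral_gaussianReal_eq_integral_smul (by simp)]
  simp only [gaussianPDFReal, smul_eq_mul, sub_zero, NNReal.coe_one, mul_one]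
  have h1 : ∀ x : ℝ, (√(2 * π))⁻¹ * rexp (-x ^ 2 / 2) * |x| =
      (fun t : ℝ => (√(2 * π))⁻¹ * (t * rexp (-(1/2) * t ^ 2))) |x| := by
    intro x
    simp only [sq_abs]
    rw [show -x ^ 2 / 2 = -(1/2) * x ^ 2 by ring]; ring
  simp_rw [h1]
  rw [integral_comp_abs (f := fun t : ℝ => (√(2 * π))⁻¹ * (t * rexp (-(1/2) * t ^ 2)))]
  rw [integral_const_mul]
  have h2 : ∫ t in Set.Ioi (0:ℝ), t * rexp (-(1/2) * t ^ 2) = 1 := by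
    have := integral_rpow_mul_exp_neg_mul_rpow (p := 2) (q := 1) (b := 1/2) (by norm_num)
      (by norm_num) (by norm_num)
    norm_num at this
    norm_num
    exact this
  rw [h2, mul_one, sqrt_div (by norm_num), sqrt_mul (by norm_num)]
  have := Real.mul_self_sqrt (show (0:ℝ) ≤ 2 by norm_num)
  have : √π ≠ 0 := by positivity
  have : √2 ≠ 0 := by positivity
  field_simp
  norm_num

lemma integrable_abs_gauss : Integrable (fun x : ℝ => |x|) (gaussianReal 0 1) :=
  ((memLp_id_gaussianReal (μ := 0) (v := 1) 1).integrable (by simp)).abs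

lemma integrable_sq_gauss : Integrable (fun x : ℝ => x ^ 2) (gaussianReal 0 1) :=
  (memLp_id_gaussianReal (μ := 0) (v := 1) 2).integrable_sq

lemma int_sq_gauss : ∫ x, x ^ 2 ∂(gaussianReal 0 1) = 1 := by
  have := variance_fun_id_gaussianReal (μ := 0) (v := 1)
  rw [variance_eq_integral measurable_id'.aemeasurable] at this
  simpa using this

lemma sgm_int (m : ℕ) (i : Fin m) (f : ℝ → ℝ) (hf : AEStronglyMeasurable f (gaussianReal 0 1)) :
    ∫ ξ, f (ξ i) ∂(_root_.stdGaussian m) = ∫ x, f x ∂(gaussianReal 0 1) := by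
  have := sgm_mp m i
  rw [← this.map_eq] at hf
  conv_rhs => rw [← this.map_eq]
  rw [integral_map this.measurable.aemeasurable hf]

lemma integrable_sq (m : ℕ) (i : Fin m) :
    Integrable (fun ξ : Fin m → ℝ => ξ i ^ 2) (_root_.stdGaussian m) :=
  (sgm_mp m i).integrable_comp_of_integrable integrable_sq_gauss

lemma integrable_abs (m : ℕ) (i : Fin m) :
    Integrable (fun ξ : Fin m → ℝ => |ξ i|) (_root_.stdGaussian m) :=
  (sgm_mp m i).integrable_comp_of_integrable integrable_abs_gauss

lemma integrable_ev (m : ℕ) (i : Fin m) :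
    Integrable (fun ξ : Fin m → ℝ => ξ i) (_root_.stdGaussian m) :=
  (sgm_mp m i).integrable_comp_of_integrable 
    ((memLp_id_gaussianReal (μ := 0) (v := 1) 1).integrable (by simp))

lemma int_lin (m : ℕ) (a : Fin m → ℝ) :
    ∫ ξ, |∑ i, a i * ξ i| ∂(_root_.stdGaussian m) = √(∑ i, a i ^ 2) * √(2 / π) := by
  let L : StrongDual ℝ (Fin m → ℝ) := ∑ i, a i • ContinuousLinearMap.proj (R := ℝ) (φ := fun _ : Fin m => ℝ) i
  have hL : ∀ ξ, L ξ = ∑ i, a i * ξ i := by intro ξ; simp [L]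
  have h0 := IsGaussian.map_eq_gaussianReal (μ := _root_.stdGaussian m) L
  have hm : ∫ ξ, L ξ ∂(_root_.stdGaussian m) = 0 := by
    simp_rw [hL]
    rw [integral_finsetSum _ (fun i _ => (integrable_ev m i).const_mul _)]
    refine Finset.sum_eq_zero fun i _ => ?_
    rw [integral_const_mul, sgm_int m i (fun x => x) (by fun_prop)]
    simp
  have hv : Var[L; _root_.stdGaussian m] = ∑ i, a i ^ 2 := by
    have : (L : (Fin m → ℝ) → ℝ) = ∑ i, (fun ξ => a i * ξ i) := by
      ext ξ; simp [hL]
    rw [this]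
    unfold _root_.stdGaussian
    rw [variance_sum_pi (X := fun i x => a i * x)]
    · refine Finset.sum_congr rfl fun i _ => ?_
      rw [variance_const_mul, variance_fun_id_gaussianReal]; simp
    · intro i
      exact (memLp_id_gaussianReal (μ := 0) (v := 1) 2).const_mul (a i)
  rw [hm, hv] at h0
  have h1 : ∫ ξ, |∑ i, a i * ξ i| ∂(_root_.stdGaussian m) = ∫ x, |x| ∂((_root_.stdGaussian m).map L) := by
    rw [integral_map (by fun_prop) (by fun_prop)]
    simp_rw [hL]
  have h2 : gaussianReal 0 (∑ i, a i ^ 2).toNNReal =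
      (gaussianReal 0 1).map (√(∑ i, a i ^ 2) * ·) := by
    rw [gaussianReal_map_const_mul]
    congr 1
    · simp
    · ext
      have : 0 ≤ ∑ i, a i ^ 2 := Finset.sum_nonneg fun i _ => sq_nonneg _
      simp [this, Real.sq_sqrt]
  rw [h1, h0, h2, integral_map (by fun_prop) (by fun_prop)]
  simp_rw [abs_mul, abs_of_nonneg (Real.sqrt_nonneg (∑ i, a i ^ 2))]
  rw [integral_const_mul, int_abs_gauss]

lemma integrable_quad (m : ℕ) (y : Fin m → ℝ) :
    Integrable (fun ξ : Fin m → ℝ => ∑ i, y i * ξ i ^ 2) (_root_.stdGaussian m) :=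
  integrable_finsetSum _ fun i _ => (integrable_sq m i).const_mul _

lemma decouple (m : ℕ) (y : Fin m → ℝ) :
    ∫ p : (Fin m → ℝ) × (Fin m → ℝ), |∑ i, y i * p.1 i * p.2 i|
      ∂((_root_.stdGaussian m).prod (_root_.stdGaussian m)) ≤
    ∫ ξ, |∑ i, y i * ξ i ^ 2| ∂(_root_.stdGaussian m) := by
  have hc : (_root_.stdGaussian m)[id] = 0 := by
    ext i
    have := (ContinuousLinearMap.proj (R := ℝ) (φ := fun _ : Fin m => ℝ) i).integral_comp_comm
      (IsGaussian.integrable_id (μ := _root_.stdGaussian m))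
    simp only [id, ContinuousLinearMap.proj_apply] at this ⊢
    rw [← this, sgm_int m i (fun x => x) (by fun_prop)]
    simp
  have hr := IsGaussian.map_rotation_eq_self hc (π / 4)
  have hq := (integrable_quad m y).abs
  rw [← hr, integral_map (by fun_prop) (by fun_prop)]
  have hs : √2 * √2 = 2 := Real.mul_self_sqrt (by norm_num)
  calc _ ≤ ∫ p : (Fin m → ℝ) × (Fin m → ℝ), (1/2) * (|∑ i, y i * p.1 i ^ 2| + |∑ i, y i * p.2 i ^ 2|)
      ∂((_root_.stdGaussian m).prod (_root_.stdGaussian m)) := by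
        refine integral_mono_of_nonneg (Filter.Eventually.of_forall fun _ => abs_nonneg _)
          (((hq.comp_fst _).add (hq.comp_snd _)).const_mul _) (Filter.Eventually.of_forall fun p => ?_)
        have : ∑ i, y i * (ContinuousLinearMap.rotation (π / 4) p).1 i *
            (ContinuousLinearMap.rotation (π / 4) p).2 i =
            (1/2) * (∑ i, y i * p.2 i ^ 2 - ∑ i, y i * p.1 i ^ 2) := by
          rw [← Finset.sum_sub_distrib, Finset.mul_sum]
          refine Finset.sum_congr rfl fun i _ => ?_
          simp [ContinuousLinearMap.rotation_apply]
          linear_combination (y i / 4 * (p.2 i ^ 2 - p.1 i ^ 2)) * hs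
        dsimp only
        rw [this, abs_mul, abs_of_pos (by norm_num : (0:ℝ) < 1/2)]
        have := abs_sub (∑ i, y i * p.2 i ^ 2) (∑ i, y i * p.1 i ^ 2)
        linarith
    _ = _ := by
        rw [integral_const_mul, integral_add (hq.comp_fst _) (hq.comp_snd _)]
        rw [integral_fun_fst (fun ξ : Fin m → ℝ => |∑ i, y i * ξ i ^ 2|),
          integral_fun_snd (fun ξ : Fin m → ℝ => |∑ i, y i * ξ i ^ 2|)]
        simp
        ring

lemma main_ineq (m : ℕ) (y : Fin m → ℝ) :
    (2 / π) * √(∑ i, y i ^ 2) ≤ ∫ ξ, |∑ i, y i * ξ i ^ 2| ∂(_root_.stdGaussian m) := by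
  refine le_trans ?_ (decouple m y)
  have hf : Integrable (fun p : (Fin m → ℝ) × (Fin m → ℝ) => |∑ i, y i * p.1 i * p.2 i|)
      ((_root_.stdGaussian m).prod (_root_.stdGaussian m)) :=
    (integrable_finsetSum _ fun i _ =>
      ((integrable_ev m i).const_mul (y i)).mul_prod (integrable_ev m i)).abs
  have hg := hf.integral_prod_left
  rw [integral_prod _ hf]
  have h1 : ∀ g : Fin m → ℝ, ∫ h, |∑ i, y i * g i * h i| ∂(_root_.stdGaussian m) =
      √(∑ i, (y i * g i) ^ 2) * √(2 / π) := fun g => int_lin m fun i => y i * g i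
  simp only [h1] at hg ⊢
  set N := √(∑ i, y i ^ 2) with hN
  have hS : 0 ≤ ∑ i, y i ^ 2 := Finset.sum_nonneg fun i _ => sq_nonneg _
  rcases (Real.sqrt_nonneg (∑ i, y i ^ 2)).eq_or_lt with h | hpos
  · rw [hN, ← h, mul_zero]
    exact integral_nonneg fun g => by positivity
  have hNN : N ^ 2 = ∑ i, y i ^ 2 := Real.sq_sqrt hS
  have hpos' : 0 < N := hpos
  calc (2 / π) * N = ∫ g : Fin m → ℝ, ∑ i, (y i ^ 2 / N * √(2 / π)) * |g i| ∂(_root_.stdGaussian m) := by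
        rw [integral_finsetSum _ (fun i _ => (integrable_abs m i).const_mul _)]
        have : ∀ i, ∫ g : Fin m → ℝ, (y i ^ 2 / N * √(2 / π)) * |g i| ∂(_root_.stdGaussian m)
          = y i ^ 2 * (2 / π / N) := by
          intro i
          rw [integral_const_mul, sgm_int m i (fun x => |x|) (by fun_prop), int_abs_gauss]
          have := Real.mul_self_sqrt (show (0:ℝ) ≤ 2 / π by positivity)
          rw [mul_assoc, this]; ring
        simp_rw [this]
        rw [← Finset.sum_mul, ← hNN]
        field_simp
    _ ≤ _ := by
        refine integral_mono (integrable_finsetSum _ fun i _ => (integrable_abs m i).const_mul _) hg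
          fun g => ?_
        dsimp only
        have hcs := Real.sum_mul_le_sqrt_mul_sqrt Finset.univ (fun i => |y i|) (fun i => |y i * g i|)
        simp only [sq_abs] at hcs
        have : ∑ i, (y i ^ 2 / N * √(2 / π)) * |g i| =
            (∑ i, |y i| * |y i * g i|) / N * √(2 / π) := by
          rw [Finset.sum_div, Finset.sum_mul]
          refine Finset.sum_congr rfl fun i _ => ?_
          rw [abs_mul, ← sq_abs (y i)]; ring
        rw [this]
        refine mul_le_mul_of_nonneg_right ?_ (Real.sqrt_nonneg _)
        rw [div_le_iff₀ hpos']
        linarith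

/-- for a standard Gaussian `ξ` in `ℝᵐ`, `E|∑ i, y_i ξ_i²| ≥ (2/π)‖y‖₂`
for every `y`; consequently, for `m = k + 1 > 1` and `γ ≥ 0`,
`θ_m(γ) ≥ (1/2)(1 − γ + (2/π)√(1 + γ²/(m−1)))₊`. -/
theorem stmt18 (k : ℕ) (hk : 0 < k) (γ : ℝ) (hγ : 0 ≤ γ) :
    (∀ y : Fin (k + 1) → ℝ,
      (2 / π) * Real.sqrt (∑ i, y i ^ 2) ≤
        ∫ ξ : Fin (k + 1) → ℝ, |∑ i, y i * ξ i ^ 2| ∂(stdGaussian (k + 1))) ∧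
    (1 / 2) * max (1 - γ + (2 / π) * Real.sqrt (1 + γ ^ 2 / k)) 0 ≤
      ∫ ξ : Fin (k + 1) → ℝ,
        max (ξ 0 ^ 2 - (γ / k) * ∑ j : Fin k, ξ j.succ ^ 2) 0 ∂(stdGaussian (k + 1)) := by
  refine ⟨main_ineq (k + 1), ?_⟩
  have hk' : (k : ℝ) ≠ 0 := by positivity
  let y : Fin (k + 1) → ℝ := Fin.cons 1 (fun _ => -(γ / k))
  have hy : ∀ ξ : Fin (k + 1) → ℝ, ξ 0 ^ 2 - (γ / k) * ∑ j : Fin k, ξ j.succ ^ 2 =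
      ∑ i, y i * ξ i ^ 2 := by
    intro ξ
    rw [Fin.sum_univ_succ, Finset.mul_sum]
    simp [y, sub_eq_add_neg]
  have hy2 : ∑ i, y i ^ 2 = 1 + γ ^ 2 / k := by
    rw [Fin.sum_univ_succ]
    simp [y]
    field_simp
  have hy1 : ∑ i, y i = 1 - γ := by
    rw [Fin.sum_univ_succ]
    simp [y]
    field_simp
    ring
  have hm := main_ineq (k + 1) y
  rw [hy2] at hm
  have hq := integrable_quad (k + 1) y
  have hE : ∫ ξ : Fin (k + 1) → ℝ, ∑ i, y i * ξ i ^ 2 ∂(_root_.stdGaussian (k + 1)) = 1 - γ := by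
    rw [integral_finsetSum _ (fun i _ => (integrable_sq _ i).const_mul _), ← hy1]
    refine Finset.sum_congr rfl fun i _ => ?_
    rw [integral_const_mul, sgm_int _ i (fun x => x ^ 2) (by fun_prop), int_sq_gauss, mul_one]
  simp_rw [hy]
  have hmax : ∀ t : ℝ, max t 0 = (1 / 2) * (t + |t|) := by
    intro t
    rcases le_total 0 t with h | h
    · rw [max_eq_left h, abs_of_nonneg h]; ring
    · rw [max_eq_right h, abs_of_nonpos h]; ring
  rw [mul_max_of_nonneg _ _ (by norm_num : (0:ℝ) ≤ 1 / 2), mul_zero]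
  refine max_le ?_ (integral_nonneg fun ξ => le_max_right _ _)
  have : ∫ ξ : Fin (k + 1) → ℝ, max (∑ i, y i * ξ i ^ 2) 0 ∂(_root_.stdGaussian (k + 1)) =
      (1 / 2) * (1 - γ + ∫ ξ : Fin (k + 1) → ℝ, |∑ i, y i * ξ i ^ 2| ∂(_root_.stdGaussian (k + 1))) := by
    simp_rw [hmax]
    rw [integral_const_mul, integral_add hq hq.abs, hE]
  rw [this]
  linarith
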